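/- Fix k ≥ 3 and assume c_2 > 0. Suppose there exists a finite Borel measure K on ℝ with all moments finite such that c_i = ∫_ℝ y^{i−2} dK(y) for all i ≥ 2, and suppose there exists a function μ : (0,∞) → ℝ with μ(t) ≠ 0 for all t > 0 such that for all 0 < s < t: E[μ(s) M_k(X_s,s) | F_{≥t}] = μ(t) M_k(X_t,t) almost surely, where F_{≥t} = σ(X_u : u ≥ t). Then c_i = 0 for all i ≥ 3 (so the process is Gaussian). -/

import Mathlib

open MeasureTheory ProbabilityTheory Filter

/-- Moment functions `m_n(t)` defined recursively from the cumulant sequence `c`: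
`m_0(t) = 1`, `m_{n+1}(t) = t * Σ_{j=0}^n C(n,j) c_{j+1} m_{n-j}(t)`. -/
noncomputable def mo (c : ℕ → ℝ) : ℕ → ℝ → ℝ
  | 0 => fun _ => 1
  | n + 1 => fun t =>
      t * ∑ j ∈ Finset.range (n + 1), (n.choose j : ℝ) * c (j + 1) * mo c (n - j) t
  decreasing_by omega

/-- The polynomial martingales `M_n(x,t) = Σ_{j=0}^n C(n,j) m_{n-j}(-t) x^j`. -/
noncomputable def Mp (c : ℕ → ℝ) (n : ℕ) (x t : ℝ) : ℝ :=
  ∑ j ∈ Finset.range (n + 1), (n.choose j : ℝ) * mo c (n - j) (-t) * x ^ j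

/-- `X` is a real-valued Lévy process under `P`: starts at `0` a.s., has stationary
increments, and independent increments over any increasing sequence of times. -/
structure IsLevy {Ω : Type*} [MeasurableSpace Ω] (P : Measure Ω) (X : ℝ → Ω → ℝ) : Prop where
  measurable : ∀ t : ℝ, Measurable (X t)
  init : ∀ᵐ ω ∂P, X 0 ω = 0
  stationary : ∀ s t : ℝ, 0 ≤ s → s ≤ t →
    Measure.map (fun ω => X t ω - X s ω) P = Measure.map (X (t - s)) P
  indep : ∀ (m : ℕ) (ts : Fin (m + 1) → ℝ), (∀ i, 0 ≤ ts i) → Monotone ts →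
    iIndepFun (m := fun _ : Fin m => (inferInstance : MeasurableSpace ℝ))
      (fun i ω => X (ts i.succ) ω - X (ts i.castSucc) ω) P

/-- The σ-algebra `F_{≤ s} = σ(X_u : 0 ≤ u ≤ s)`. -/
def filtLE {Ω : Type*} [MeasurableSpace Ω] (X : ℝ → Ω → ℝ) (s : ℝ) : MeasurableSpace Ω :=
  ⨆ u ∈ Set.Icc (0 : ℝ) s, MeasurableSpace.comap (X u) inferInstance

/-- The σ-algebra `F_{≥ t} = σ(X_u : u ≥ t)`. -/
def filtGE {Ω : Type*} [MeasurableSpace Ω] (X : ℝ → Ω → ℝ) (t : ℝ) : MeasurableSpace Ω :=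
  ⨆ u ∈ Set.Ici t, MeasurableSpace.comap (X u) inferInstance

theorem ps_unique (g d : PowerSeries ℝ) (h : PowerSeries.derivative ℝ d = g * d)
    (h0 : PowerSeries.coeff 0 d = 0) : d = 0 := by
  have key : ∀ n, ∀ m ≤ n, PowerSeries.coeff m d = 0 := by
    intro n
    induction n with
    | zero => intro m hm; obtain rfl : m = 0 := by omega
              exact h0
    | succ n ih =>
      intro m hm
      rcases Nat.lt_or_ge m (n+1) with h1 | h1
      · exact ih m (by omega)
      obtain rfl : m = n + 1 := by omega
      have h2 := congrArg (PowerSeries.coeff n) h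
      rw [PowerSeries.coeff_derivative, PowerSeries.coeff_mul, Finset.sum_eq_zero] at h2
      · have : (n:ℝ) + 1 ≠ 0 := by positivity
        simpa [this] using h2
      · intro x hx
        rw [ih x.2 (by have := Finset.HasAntidiagonal.mem_antidiagonal.1 hx; omega), mul_zero]
  ext n
  simpa using key n n le_rfl

theorem mo_zero' (c : ℕ → ℝ) (t : ℝ) : mo c 0 t = 1 := by simp [mo]
theorem mo_succ' (c : ℕ → ℝ) (n : ℕ) (t : ℝ) : mo c (n+1) t =
    t * ∑ j ∈ Finset.range (n + 1), (n.choose j : ℝ) * c (j + 1) * mo c (n - j) t := by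
  rw [mo]

/-- exponential generating functions -/
noncomputable def egf (a : ℕ → ℝ) : PowerSeries ℝ := PowerSeries.mk (fun n => a n / (n.factorial : ℝ))

theorem egf_inj {a b : ℕ → ℝ} (h : egf a = egf b) (n : ℕ) : a n = b n := by
  have := congrArg (PowerSeries.coeff n) h
  have h2 : (n.factorial : ℝ) ≠ 0 := by positivity
  simpa [egf, div_left_inj' h2] using this

theorem egf_deriv (a : ℕ → ℝ) : PowerSeries.derivative ℝ (egf a) = egf (fun n => a (n+1)) := by
  ext n
  have h2 : (n.factorial : ℝ) ≠ 0 := by positivity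
  have h3 : (n:ℝ) + 1 ≠ 0 := by positivity
  simp only [PowerSeries.coeff_derivative, egf, PowerSeries.coeff_mk, Nat.factorial_succ]
  push_cast
  field_simp

theorem egf_mul (a b : ℕ → ℝ) : egf a * egf b =
    egf (fun n => ∑ j ∈ Finset.range (n+1), (n.choose j : ℝ) * a j * b (n-j)) := by
  ext n
  simp only [PowerSeries.coeff_mul, egf, PowerSeries.coeff_mk]
  rw [Finset.Nat.sum_antidiagonal_eq_sum_range_succ_mk, Finset.sum_div]
  refine Finset.sum_congr rfl fun j hj => ?_
  have hj : j ≤ n := by simpa [Nat.lt_succ_iff] using hj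
  rw [Nat.cast_choose ℝ hj]
  have h2 : (n.factorial : ℝ) ≠ 0 := by positivity
  field_simp

theorem egf_smul (t : ℝ) (a : ℕ → ℝ) : egf (fun n => t * a n) = PowerSeries.C t * egf a := by
  ext n; simp [egf, mul_div_assoc]

theorem egf_mo (c : ℕ → ℝ) (t : ℝ) : PowerSeries.derivative ℝ (egf (fun n => mo c n t)) =
    PowerSeries.C t * egf (fun n => c (n+1)) * egf (fun n => mo c n t) := by
  rw [egf_deriv, mul_assoc, egf_mul, ← egf_smul]
  simp only [mo_succ']

theorem egf_mo_add (c : ℕ → ℝ) (s t : ℝ) :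
    egf (fun n => mo c n s) * egf (fun n => mo c n t) = egf (fun n => mo c n (s+t)) := by
  rw [← sub_eq_zero]
  apply ps_unique (PowerSeries.C (s+t) * egf (fun n => c (n+1)))
  · rw [map_sub, Derivation.leibniz, egf_mo, egf_mo, egf_mo, map_add]
    simp only [smul_eq_mul]
    ring
  · simp [egf, mo_zero']

theorem mo_add (c : ℕ → ℝ) (s t : ℝ) (n : ℕ) : mo c n (s+t) =
    ∑ j ∈ Finset.range (n+1), (n.choose j : ℝ) * mo c j s * mo c (n-j) t := by
  have := egf_mo_add c s t
  rw [egf_mul] at this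
  exact (egf_inj this n).symm

theorem mo_at_zero (c : ℕ → ℝ) (n : ℕ) : mo c n 0 = if n = 0 then 1 else 0 := by
  cases n with
  | zero => simp [mo_zero']
  | succ n => simp [mo_succ']

theorem egf_Mp (c : ℕ → ℝ) (x t : ℝ) : egf (fun n => Mp c n x t) =
    egf (fun n => x ^ n) * egf (fun n => mo c n (-t)) := by
  rw [egf_mul]
  congr 1; funext n
  rw [Mp]
  exact Finset.sum_congr rfl fun j _ => by ring

theorem Mp_succ (c : ℕ → ℝ) (x t : ℝ) (n : ℕ) : Mp c (n+1) x t = x * Mp c n x t -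
    t * ∑ j ∈ Finset.range (n+1), (n.choose j : ℝ) * c (j+1) * Mp c (n-j) x t := by
  have h : egf (fun n => Mp c (n+1) x t) = egf (fun n => x * Mp c n x t) +
      egf (fun n => (-t) * ∑ j ∈ Finset.range (n+1), (n.choose j : ℝ) * c (j+1) * Mp c (n-j) x t) := by
    rw [egf_smul, egf_smul, ← egf_mul (fun n => c (n+1)) (fun n => Mp c n x t),
      ← egf_deriv (fun n => Mp c n x t), egf_Mp, Derivation.leibniz, egf_mo, egf_deriv]
    simp only [pow_succ', egf_smul, smul_eq_mul]
    ring
  have h2 : ∀ a b : ℕ → ℝ, egf a + egf b = egf (fun n => a n + b n) := by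
    intro a b; ext n; simp [egf, add_div]
  rw [h2] at h
  rw [egf_inj h n]
  ring

section aux
open Polynomial

/-- `M_n(·,t)` as a polynomial -/
noncomputable def MP (c : ℕ → ℝ) (n : ℕ) (t : ℝ) : ℝ[X] :=
  ∑ j ∈ Finset.range (n + 1), monomial j ((n.choose j : ℝ) * mo c (n - j) (-t))

theorem MP_eval (c : ℕ → ℝ) (n : ℕ) (t x : ℝ) : (MP c n t).eval x = Mp c n x t := by
  simp [MP, Mp, eval_finsetSum]

theorem MP_coeff (c : ℕ → ℝ) (n m : ℕ) (t : ℝ) :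
    (MP c n t).coeff m = (n.choose m : ℝ) * mo c (n - m) (-t) := by
  simp only [MP, finsetSum_coeff, coeff_monomial]
  rw [Finset.sum_ite_eq' (Finset.range (n+1)) m]
  split_ifs with h
  · rfl
  · rw [Nat.choose_eq_zero_of_lt (by simpa using h)]; simp

theorem MP_hasse (c : ℕ → ℝ) (n i : ℕ) (t : ℝ) :
    hasseDeriv i (MP c n t) = (n.choose i : ℝ) • MP c (n-i) t := by
  ext m
  rw [hasseDeriv_coeff, coeff_smul, MP_coeff, MP_coeff, smul_eq_mul, ← mul_assoc, ← mul_assoc,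
    Nat.sub_sub, Nat.add_comm i m]
  congr 1
  norm_cast
  rcases Nat.lt_or_ge n (m+i) with h | h
  · rw [Nat.choose_eq_zero_of_lt h, mul_zero]
    rcases Nat.lt_or_ge n i with h' | h'
    · rw [Nat.choose_eq_zero_of_lt h', zero_mul]
    · rw [Nat.choose_eq_zero_of_lt (by omega : n - i < m), mul_zero]
  · rw [mul_comm, Nat.choose_mul (by omega) ]
    congr 2; omega

theorem MP_succ (c : ℕ → ℝ) (t : ℝ) (n : ℕ) : MP c (n+1) t = X * MP c n t -
    t • ∑ j ∈ Finset.range (n+1), ((n.choose j : ℝ) * c (j+1)) • MP c (n-j) t := by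
  apply Polynomial.funext
  intro x
  simp only [eval_sub, eval_mul, eval_X, eval_smul, eval_finsetSum, MP_eval, smul_eq_mul]
  exact Mp_succ c x t n

theorem MP_natDegree (c : ℕ → ℝ) (t : ℝ) (n : ℕ) : (MP c n t).natDegree ≤ n := by
  rw [natDegree_le_iff_coeff_eq_zero]
  intro m hm
  rw [MP_coeff, Nat.choose_eq_zero_of_lt hm]; simp

/-- the moment functional -/
noncomputable def Lf (c : ℕ → ℝ) (t : ℝ) : ℝ[X] →ₗ[ℝ] ℝ :=
  Polynomial.lsum (fun n => mo c n t • LinearMap.id)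

theorem Lf_monomial (c : ℕ → ℝ) (t : ℝ) (n : ℕ) (a : ℝ) :
    Lf c t (monomial n a) = a * mo c n t := by
  simp [Lf, mul_comm]

theorem Lf_X_mul (c : ℕ → ℝ) (t : ℝ) (N : ℕ) (p : ℝ[X]) (hp : p.natDegree < N) :
    Lf c t (X * p) = t * ∑ j ∈ Finset.range N, c (j+1) * Lf c t (hasseDeriv j p) := by
  have mon : ∀ n < N, ∀ a, Lf c t (X * monomial n a) =
      t * ∑ j ∈ Finset.range N, c (j+1) * Lf c t (hasseDeriv j (monomial n a)) := by
    intro n hn a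
    simp only [X_mul_monomial, hasseDeriv_monomial, Lf_monomial, mo_succ']
    rw [← Finset.sum_subset (Finset.range_subset_range.2 (by omega : n + 1 ≤ N))]
    · rw [Finset.mul_sum, Finset.mul_sum, Finset.mul_sum]
      exact Finset.sum_congr rfl fun j _ => by ring
    · intro j _ hj
      rw [Nat.choose_eq_zero_of_lt (by simpa using hj)]; simp
  rw [p.as_sum_range' N hp]
  simp only [Finset.mul_sum, map_sum]
  rw [Finset.sum_comm]
  refine Finset.sum_congr rfl fun n hn => ?_
  rw [mon n (by simpa using hn), Finset.mul_sum]

/-- `E[M_k M_n]` -/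
noncomputable def HH (c : ℕ → ℝ) (k n : ℕ) (t : ℝ) : ℝ := Lf c t (MP c k t * MP c n t)

theorem reindex (k n : ℕ) (F : ℕ → ℕ → ℝ) (h1 : ∀ i l, k < i → F i l = 0)
    (h2 : ∀ i l, n < l → F i l = 0) :
    ∑ j ∈ Finset.range (k+n+1), ∑ x ∈ Finset.HasAntidiagonal.antidiagonal j, F x.1 x.2 =
    ∑ i ∈ Finset.range (k+1), ∑ l ∈ Finset.range (n+1), F i l := by
  rw [← Finset.sum_product', ← Finset.sum_fiberwise_of_maps_to (g := fun x : ℕ × ℕ => x.1 + x.2)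
    (t := Finset.range (k+n+1))]
  · refine Finset.sum_congr rfl fun j hj => ?_
    symm
    apply Finset.sum_subset
    · intro x hx
      simp at hx ⊢
      exact hx.2
    · intro x hx hx2
      simp at hx hx2
      by_cases h : k < x.1
      · exact h1 _ _ h
      · apply h2
        by_contra h3
        exact hx2 (by omega) (by omega) hx
  · intro x hx
    simp at hx ⊢
    omega

theorem HH_succ (c : ℕ → ℝ) (k n : ℕ) (t : ℝ) : HH c k (n+1) t =
    t * ∑ i ∈ Finset.range k, ∑ l ∈ Finset.range (n+1),
      c (i+1+l+1) * ((k.choose (i+1) : ℝ) * (n.choose l : ℝ)) * HH c (k-(i+1)) (n-l) t := by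
  have hd : (MP c k t * MP c n t).natDegree < k + n + 1 := by
    have := natDegree_mul_le (p := MP c k t) (q := MP c n t)
    have := MP_natDegree c t k
    have := MP_natDegree c t n
    omega
  have e : MP c k t * MP c (n+1) t = X * (MP c k t * MP c n t) -
    t • ∑ j ∈ Finset.range (n+1), ((n.choose j : ℝ) * c (j+1)) • (MP c k t * MP c (n-j) t) := by
    rw [MP_succ]
    simp only [mul_sub, mul_smul_comm, Finset.mul_sum]
    ring
  rw [HH, e, map_sub, Lf_X_mul c t _ _ hd, map_smul, map_sum, smul_eq_mul, ← mul_sub]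
  congr 1
  have e2 : ∑ j ∈ Finset.range (k+n+1), c (j+1) * Lf c t (hasseDeriv j (MP c k t * MP c n t)) =
      ∑ j ∈ Finset.range (k+n+1), ∑ x ∈ Finset.HasAntidiagonal.antidiagonal j,
       (fun i l => c (i+l+1) * ((k.choose i : ℝ) * (n.choose l : ℝ)) * HH c (k-i) (n-l) t) x.1 x.2 := by
    refine Finset.sum_congr rfl fun j _ => ?_
    rw [hasseDeriv_mul, map_sum, Finset.mul_sum]
    refine Finset.sum_congr rfl fun x hx => ?_
    have hx := Finset.HasAntidiagonal.mem_antidiagonal.1 hx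
    simp only [MP_hasse, HH, hx, smul_mul_smul_comm, map_smul, smul_eq_mul]
    ring
  rw [e2, reindex k n (fun i l => c (i+l+1) * ((k.choose i : ℝ) * (n.choose l : ℝ)) * HH c (k-i) (n-l) t),
    Finset.sum_range_succ', add_sub_assoc]
  · simp only [add_eq_left, sub_eq_zero]
    refine Finset.sum_congr rfl fun j _ => ?_
    simp only [HH, map_smul, smul_eq_mul, Nat.choose_zero_right, Nat.sub_zero, zero_add, Nat.cast_one]; ring
  · intro i l h; simp [Nat.choose_eq_zero_of_lt h]
  · intro i l h; simp [Nat.choose_eq_zero_of_lt h]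

theorem HH_zero (c : ℕ → ℝ) (k : ℕ) (t : ℝ) : HH c k 0 t = if k = 0 then 1 else 0 := by
  have h : MP c 0 t = 1 := by simp [MP, mo_zero']
  rw [HH, h, mul_one, ← mo_at_zero c, ← add_neg_cancel t, mo_add, MP, map_sum]
  refine Finset.sum_congr rfl fun j _ => ?_
  rw [Lf_monomial]; ring

theorem HH_one (c : ℕ → ℝ) (k : ℕ) (hk : 1 ≤ k) (t : ℝ) : HH c k 1 t = t * c (k+1) := by
  obtain ⟨k, rfl⟩ : ∃ k', k = k' + 1 := ⟨k-1, by omega⟩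
  rw [HH_succ, Finset.sum_range_succ, Finset.sum_eq_zero]
  · simp [HH_zero]
  · intro i hi
    have hi := Finset.mem_range.1 hi
    have : k + 1 - (i+1) ≠ 0 := by omega
    simp [HH_zero]
    omega

theorem HH_two (c : ℕ → ℝ) (k : ℕ) (hk : 1 ≤ k) :
    ∃ A : ℝ, ∀ t, HH c k 2 t = t * c (k+2) + t^2 * A := by
  obtain ⟨k, rfl⟩ : ∃ k', k = k' + 1 := ⟨k-1, by omega⟩
  refine ⟨∑ i ∈ Finset.range k, c (i+1+1) * ((k+1).choose (i+1) : ℝ) * c (k - i + 1), fun t => ?_⟩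
  rw [HH_succ, Finset.sum_range_succ]
  have h0 : HH c 0 1 t = 0 := by rw [HH_succ]; simp
  have : ∀ i ∈ Finset.range k, ∑ l ∈ Finset.range (1+1),
      c (i+1+l+1) * (((k+1).choose (i+1) : ℝ) * ((1:ℕ).choose l : ℝ)) * HH c (k+1-(i+1)) (1-l) t
      = t * (c (i+1+1) * ((k+1).choose (i+1) : ℝ) * c (k - i + 1)) := by
    intro i hi
    have hi := Finset.mem_range.1 hi
    have h2 : k - i ≠ 0 := by omega
    simp only [Finset.sum_range_succ, Finset.sum_range_zero]
    simp only [Nat.add_sub_add_right, Nat.sub_zero, Nat.sub_self, HH_zero, h2, if_false]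
    rw [HH_one c _ (by omega)]
    simp; ring
  rw [Finset.sum_congr rfl this, ← Finset.mul_sum]
  simp [Finset.sum_range_succ, HH_zero, h0]
  ring

theorem HH_lim (c : ℕ → ℝ) (m : ℕ) : ∀ k n, k ≤ m → n ≤ m →
    Tendsto (fun t => HH c k n t / t ^ m) atTop
      (nhds (if k = m ∧ n = m then (m.factorial : ℝ) * c 2 ^ m else 0)) := by
  induction m with
  | zero =>
    intro k n hk hn
    obtain rfl : k = 0 := by omega
    obtain rfl : n = 0 := by omega
    simp [HH_zero]
  | succ m ih =>
    intro k n hk hn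
    cases n with
    | zero =>
      simp only [HH_zero]
      rw [if_neg (fun h : k = m+1 ∧ 0 = m+1 => absurd h.2 (Nat.succ_ne_zero m).symm)]
      exact tendsto_const_nhds.div_atTop (tendsto_pow_atTop (Nat.succ_ne_zero m))
    | succ n =>
      have h1 : Tendsto (fun t => ∑ i ∈ Finset.range k, ∑ l ∈ Finset.range (n+1),
          c (i+1+l+1) * ((k.choose (i+1) : ℝ) * (n.choose l : ℝ)) *
            (HH c (k-(i+1)) (n-l) t / t ^ m)) atTop
          (nhds (∑ i ∈ Finset.range k, ∑ l ∈ Finset.range (n+1),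
          c (i+1+l+1) * ((k.choose (i+1) : ℝ) * (n.choose l : ℝ)) *
            (if k-(i+1) = m ∧ n - l = m then (m.factorial : ℝ) * c 2 ^ m else 0))) := by
        refine tendsto_finsetSum _ fun i _ => tendsto_finsetSum _ fun l _ => ?_
        exact (ih _ _ (by omega) (by omega)).const_mul _
      have h2 : (∑ i ∈ Finset.range k, ∑ l ∈ Finset.range (n+1),
          c (i+1+l+1) * ((k.choose (i+1) : ℝ) * (n.choose l : ℝ)) *
            (if k-(i+1) = m ∧ n - l = m then (m.factorial : ℝ) * c 2 ^ m else 0)) =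
          (if k = m+1 ∧ n+1 = m+1 then ((m+1).factorial : ℝ) * c 2 ^ (m+1) else 0) := by
        split_ifs with h
        · obtain ⟨rfl, h⟩ := h
          obtain rfl : n = m := by omega
          rw [Finset.sum_eq_single 0, Finset.sum_eq_single 0]
          · simp [Nat.factorial_succ]; ring
          · intro l hl hl0
            rw [if_neg (by have := Finset.mem_range.1 hl; omega), mul_zero]
          · simp
          · intro i hi hi0
            refine Finset.sum_eq_zero fun l hl => ?_
            rw [if_neg (by have := Finset.mem_range.1 hi; omega), mul_zero]
          · simp
        · refine Finset.sum_eq_zero fun i hi => Finset.sum_eq_zero fun l hl => ?_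
          have := Finset.mem_range.1 hi
          have := Finset.mem_range.1 hl
          rw [if_neg (by omega), mul_zero]
      rw [h2] at h1
      refine h1.congr' ?_
      filter_upwards [eventually_gt_atTop 0] with t ht
      rw [HH_succ, pow_succ', mul_div_mul_left _ _ ht.ne', Finset.sum_div]
      refine Finset.sum_congr rfl fun i _ => ?_
      rw [Finset.sum_div]
      exact Finset.sum_congr rfl fun l _ => by ring

theorem Mp_add (c : ℕ → ℝ) (n : ℕ) (x y t : ℝ) : Mp c n (x+y) t =
    ∑ i ∈ Finset.range (n+1), (n.choose i : ℝ) * y ^ i * Mp c (n-i) x t := by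
  have h : egf (fun n => (x+y)^n) = egf (fun n => y^n) * egf (fun n => x^n) := by
    rw [egf_mul]
    congr 1; funext n
    rw [add_comm x y, add_pow]
    exact Finset.sum_congr rfl fun j _ => by ring
  have h2 := egf_Mp c (x+y) t
  rw [h, mul_assoc, ← egf_Mp, egf_mul] at h2
  exact egf_inj h2 n

theorem Mp_shift (c : ℕ → ℝ) (n : ℕ) (x s t : ℝ) : Mp c n x s =
    ∑ i ∈ Finset.range (n+1), (n.choose i : ℝ) * mo c i (t-s) * Mp c (n-i) x t := by
  have h2 := egf_Mp c x s
  rw [show -s = (t-s) + -t by ring, ← egf_mo_add, mul_left_comm, ← egf_Mp, egf_mul] at h2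
  exact egf_inj h2 n

section prob
variable {Ω : Type*} [MeasurableSpace Ω] {P : Measure Ω} [IsProbabilityMeasure P]
    {X : ℝ → Ω → ℝ} {c : ℕ → ℝ}

theorem int_pow (hX : IsLevy P X)
    (hmom : ∀ (n : ℕ) (t : ℝ), 0 ≤ t → Integrable (fun ω => |X t ω| ^ n) P)
    (t : ℝ) (ht : 0 ≤ t) (n : ℕ) : Integrable (fun ω => X t ω ^ n) P := by
  refine (hmom n t ht).mono' ((hX.measurable t).pow_const n).aestronglyMeasurable ?_
  filter_upwards with ω
  simp

theorem int_poly (hX : IsLevy P X)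
    (hmom : ∀ (n : ℕ) (t : ℝ), 0 ≤ t → Integrable (fun ω => |X t ω| ^ n) P)
    (t : ℝ) (ht : 0 ≤ t) (p : ℝ[X]) : Integrable (fun ω => p.eval (X t ω)) P := by
  simp only [eval_eq_sum_range]
  exact integrable_finsetSum _ fun i _ => (int_pow hX hmom t ht i).const_mul _

theorem meas_poly (hX : IsLevy P X) (t : ℝ) (p : ℝ[X]) : Measurable (fun ω => p.eval (X t ω)) :=
  p.continuous.measurable.comp (hX.measurable t)

theorem int_poly2 (hX : IsLevy P X)
    (hmom : ∀ (n : ℕ) (t : ℝ), 0 ≤ t → Integrable (fun ω => |X t ω| ^ n) P)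
    (s t : ℝ) (hs : 0 ≤ s) (ht : 0 ≤ t) (p q : ℝ[X]) :
    Integrable (fun ω => p.eval (X s ω) * q.eval (X t ω)) P := by
  refine ((int_poly hX hmom s hs (p^2)).add (int_poly hX hmom t ht (q^2))).mono'
    ((meas_poly hX s p).mul (meas_poly hX t q)).aestronglyMeasurable ?_
  filter_upwards with ω
  simp only [eval_pow, Pi.add_apply, Real.norm_eq_abs]
  rw [abs_le]
  constructor <;> nlinarith [sq_nonneg (p.eval (X s ω) + q.eval (X t ω)),
    sq_nonneg (p.eval (X s ω) - q.eval (X t ω)), sq_nonneg (p.eval (X s ω)),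
    sq_nonneg (q.eval (X t ω))]

theorem E_poly (hX : IsLevy P X)
    (hmom : ∀ (n : ℕ) (t : ℝ), 0 ≤ t → Integrable (fun ω => |X t ω| ^ n) P)
    (hm : ∀ (n : ℕ) (t : ℝ), 0 ≤ t → (∫ ω, (X t ω) ^ n ∂P) = mo c n t)
    (t : ℝ) (ht : 0 ≤ t) (p : ℝ[X]) : ∫ ω, p.eval (X t ω) ∂P = Lf c t p := by
  conv_rhs => rw [p.as_sum_range]
  simp only [eval_eq_sum_range, map_sum, Lf_monomial]
  rw [integral_finsetSum _ fun i _ => (int_pow hX hmom t ht i).const_mul _]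
  simp only [integral_const_mul, hm _ t ht]

theorem indep_incr (hX : IsLevy P X) (s t : ℝ) (hs : 0 ≤ s) (hst : s ≤ t) :
    IndepFun (X s) (fun ω => X t ω - X s ω) P := by
  have h := hX.indep 2 ![0, s, t] (by intro i; fin_cases i <;> simp <;> linarith)
    (by
      rw [Fin.monotone_iff_le_succ]
      intro i; fin_cases i <;> simp <;> linarith)
  have h2 := h.indepFun (show (0 : Fin 2) ≠ 1 by decide)
  refine h2.congr ?_ ?_
  · filter_upwards [hX.init] with ω hω
    simp [hω]
  · filter_upwards with ω
    simp

theorem mart (hX : IsLevy P X)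
    (hmom : ∀ (n : ℕ) (t : ℝ), 0 ≤ t → Integrable (fun ω => |X t ω| ^ n) P)
    (hm : ∀ (n : ℕ) (t : ℝ), 0 ≤ t → (∫ ω, (X t ω) ^ n ∂P) = mo c n t)
    (s t : ℝ) (hs : 0 ≤ s) (hst : s ≤ t) (p : ℝ[X]) (n : ℕ) :
    ∫ ω, p.eval (X s ω) * Mp c n (X t ω) t ∂P = ∫ ω, p.eval (X s ω) * Mp c n (X s ω) s ∂P := by
  have hind := indep_incr hX s t hs hst
  have hinc : ∀ i, Integrable (fun ω => (X t ω - X s ω)^i) P ∧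
      ∫ ω, (X t ω - X s ω)^i ∂P = mo c i (t-s) := by
    intro i
    have hst' := hX.stationary s t hs hst
    have hmeas : Measurable (fun ω => X t ω - X s ω) := (hX.measurable t).sub (hX.measurable s)
    have hf : Measurable (fun x : ℝ => x ^ i) := by fun_prop
    have hid : IdentDistrib (fun ω => X t ω - X s ω) (X (t-s)) P P :=
      ⟨hmeas.aemeasurable, (hX.measurable _).aemeasurable, hst'⟩
    have hid2 := hid.comp hf
    refine ⟨hid2.integrable_iff.2 (int_pow hX hmom (t-s) (by linarith) i), ?_⟩
    rw [← hm i (t-s) (by linarith)]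
    exact hid2.integral_eq
  have hind2 : ∀ (q : ℝ[X]) i, IndepFun (fun ω => q.eval (X s ω))
      (fun ω => (X t ω - X s ω)^i) P := by
    intro q i
    exact hind.comp (φ := fun x => q.eval x) (ψ := fun x => x ^ i) q.continuous.measurable (by fun_prop)
  have e1 : ∀ ω, p.eval (X s ω) * Mp c n (X t ω) t = ∑ i ∈ Finset.range (n+1),
      (n.choose i : ℝ) * ((p * MP c (n-i) t).eval (X s ω) * (X t ω - X s ω)^i) := by
    intro ω
    have := Mp_add c n (X s ω) (X t ω - X s ω) t
    rw [add_sub_cancel] at this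
    rw [this, Finset.mul_sum]
    refine Finset.sum_congr rfl fun i _ => ?_
    rw [eval_mul, MP_eval]; ring
  have e2 : ∀ ω, p.eval (X s ω) * Mp c n (X s ω) s = ∑ i ∈ Finset.range (n+1),
      (n.choose i : ℝ) * ((p * MP c (n-i) t).eval (X s ω) * mo c i (t-s)) := by
    intro ω
    rw [Mp_shift c n _ s t, Finset.mul_sum]
    refine Finset.sum_congr rfl fun i _ => ?_
    rw [eval_mul, MP_eval]; ring
  simp only [e1, e2]
  rw [integral_finsetSum, integral_finsetSum]
  · refine Finset.sum_congr rfl fun i _ => ?_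
    rw [integral_const_mul, integral_const_mul, integral_mul_const, ← (hinc i).2]
    congr 1
    exact (hind2 _ i).integral_fun_mul_eq_mul_integral
      (meas_poly hX s _).aestronglyMeasurable (hinc i).1.aestronglyMeasurable
  · intro i _
    exact ((int_poly hX hmom s hs _).mul_const _).const_mul _
  · intro i _
    exact ((hind2 _ i).integrable_mul (int_poly hX hmom s hs _) (hinc i).1).const_mul _

theorem key_eq (hX : IsLevy P X)
    (hmom : ∀ (n : ℕ) (t : ℝ), 0 ≤ t → Integrable (fun ω => |X t ω| ^ n) P)
    (hm : ∀ (n : ℕ) (t : ℝ), 0 ≤ t → (∫ ω, (X t ω) ^ n ∂P) = mo c n t)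
    (s t : ℝ) (hs : 0 < s) (hst : s < t) (k n : ℕ) (a b : ℝ)
    (h : P[(fun ω => a * Mp c k (X s ω) s) | filtGE X t]
        =ᵐ[P] fun ω => b * Mp c k (X t ω) t) :
    a * HH c k n s = b * HH c k n t := by
  have hH : ∀ t, 0 ≤ t → HH c k n t = ∫ ω, Mp c k (X t ω) t * Mp c n (X t ω) t ∂P := by
    intro t ht
    rw [HH, ← E_poly hX hmom hm t ht]
    simp only [eval_mul, MP_eval]
  have hle : filtGE X t ≤ (inferInstance : MeasurableSpace Ω) :=
    iSup₂_le fun u _ => (hX.measurable u).comap_le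
  have hZ : Measurable[filtGE X t] (fun ω => Mp c n (X t ω) t) := by
    have h1 : Measurable[filtGE X t] (X t) := by
      refine Measurable.mono (comap_measurable (X t)) ?_ le_rfl
      exact le_iSup₂_of_le (f := fun u (_ : u ∈ Set.Ici t) => MeasurableSpace.comap (X u) inferInstance) t Set.self_mem_Ici le_rfl
    have h2 : Measurable (fun x => (MP c n t).eval x) := (MP c n t).continuous.measurable
    have := h2.comp h1
    simpa only [Function.comp_def, MP_eval] using this
  have hY : Integrable (fun ω => a * Mp c k (X s ω) s) P := by
    have := (int_poly hX hmom s hs.le (MP c k s)).const_mul a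
    simpa only [MP_eval] using this
  have hYZ : Integrable ((fun ω => a * Mp c k (X s ω) s) * fun ω => Mp c n (X t ω) t) P := by
    have := (int_poly2 hX hmom s t hs.le (hs.trans hst).le (MP c k s) (MP c n t)).const_mul a
    simp only [MP_eval, ← mul_assoc] at this
    exact this
  have h1 := condExp_mul_of_stronglyMeasurable_right (m := filtGE X t) hZ.stronglyMeasurable hYZ hY
  have h2 := integral_condExp hle (μ := P)
    (f := (fun ω => a * Mp c k (X s ω) s) * fun ω => Mp c n (X t ω) t)
  rw [integral_congr_ae (h1.trans (h.mul (EventuallyEq.refl _ _)))] at h2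
  simp only [Pi.mul_apply, mul_assoc, integral_const_mul] at h2
  rw [hH t (hs.trans hst).le, h2, hH s hs.le]
  have := mart hX hmom hm s t hs.le hst.le (MP c k s) n
  simp only [MP_eval] at this
  rw [this]
end prob
end aux

/-- If `k ≥ 3`, `c_2 > 0`, the `c_i` (`i ≥ 2`) are the moments
`∫ y^{i-2} dK(y)` of a finite Borel measure `K` with all moments finite, and
`μ(t) M_k(X_t,t)` is a reversed martingale for some nowhere-vanishing `μ`, then
`c_i = 0` for all `i ≥ 3` (the process is Gaussian). -/
theorem stmt_14 {Ω : Type*} [MeasurableSpace Ω] (P : Measure Ω) [IsProbabilityMeasure P]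
    (X : ℝ → Ω → ℝ) (c : ℕ → ℝ) (hX : IsLevy P X)
    (hmom : ∀ (n : ℕ) (t : ℝ), 0 ≤ t → Integrable (fun ω => |X t ω| ^ n) P)
    (hm : ∀ (n : ℕ) (t : ℝ), 0 ≤ t → (∫ ω, (X t ω) ^ n ∂P) = mo c n t)
    (k : ℕ) (hk : 3 ≤ k) (hc2 : 0 < c 2)
    (K : Measure ℝ) (hKfin : IsFiniteMeasure K)
    (hKmom : ∀ m : ℕ, Integrable (fun y => |y| ^ m) K)
    (hcK : ∀ i : ℕ, 2 ≤ i → c i = ∫ y, y ^ (i - 2) ∂K)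
    (μ : ℝ → ℝ) (hμ : ∀ t : ℝ, 0 < t → μ t ≠ 0)
    (hrev : ∀ s t : ℝ, 0 < s → s < t →
      P[(fun ω => μ s * Mp c k (X s ω) s) | filtGE X t]
        =ᵐ[P] fun ω => μ t * Mp c k (X t ω) t) :
    ∀ i : ℕ, 3 ≤ i → c i = 0 := by
  have keq : ∀ n s t, 0 < s → s < t → μ s * HH c k n s = μ t * HH c k n t :=
    fun n s t hs hst => key_eq hX hmom hm s t hs hst k n _ _ (hrev s t hs hst)
  have keyz : ∀ n, n < k → ∀ s, 0 < s → HH c k n s = 0 := by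
    intro n hn s hs
    have l1 := HH_lim c k k n le_rfl hn.le
    have l2 := HH_lim c k k k le_rfl le_rfl
    rw [if_neg (by omega)] at l1
    rw [if_pos ⟨rfl, rfl⟩] at l2
    have l3 := l1.mul_const (HH c k k s)
    have l4 := l2.mul_const (HH c k n s)
    have l5 := l3.congr' (f₂ := fun t => HH c k k t / t ^ k * HH c k n s) (by
      filter_upwards [eventually_gt_atTop s] with t ht
      have e1 := keq n s t hs ht
      have e2 := keq k s t hs ht
      have e : HH c k n t * HH c k k s = HH c k k t * HH c k n s := by
        apply mul_left_cancel₀ (mul_ne_zero (hμ s hs) (hμ t (hs.trans ht)))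
        linear_combination (μ t * HH c k n t) * e2 - (μ t * HH c k k t) * e1
      rw [div_mul_eq_mul_div, e, div_mul_eq_mul_div])
    have := tendsto_nhds_unique l4 l5
    have hpos : (k.factorial : ℝ) * c 2 ^ k ≠ 0 := by positivity
    simpa [hpos, hc2.ne', Nat.factorial_ne_zero] using this
  have hk1 : c (k+1) = 0 := by
    have := keyz 1 (by omega) 1 one_pos
    rwa [HH_one c k (by omega), one_mul] at this
  have hk2 : c (k+2) = 0 := by
    obtain ⟨A, hA⟩ := HH_two c k (by omega)
    have h1 := keyz 2 (by omega) 1 one_pos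
    have h2 := keyz 2 (by omega) 2 two_pos
    rw [hA] at h1 h2
    linarith
  obtain ⟨r, hr, hr0⟩ : ∃ r : ℕ, 1 ≤ r ∧ c (2*r+2) = 0 := by
    rcases Nat.even_or_odd' k with ⟨r, h | h⟩
    · exact ⟨r, by omega, by rw [← h]; exact hk2⟩
    · exact ⟨r, by omega, by rw [← hk1, h]⟩
  rw [hcK _ (by omega), Nat.add_sub_cancel] at hr0
  have hint : ∀ m : ℕ, Integrable (fun y : ℝ => y ^ m) K := by
    intro m
    refine (hKmom m).mono' (by fun_prop) ?_
    filter_upwards with y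
    simp
  rw [integral_eq_zero_iff_of_nonneg (fun y => by simp only [Pi.zero_apply]; rw [pow_mul]; positivity) (hint _)] at hr0
  intro i hi
  rw [hcK i (by omega)]
  refine integral_eq_zero_of_ae ?_
  filter_upwards [hr0] with y hy
  have : y = 0 := by
    simp only [Pi.zero_apply] at hy
    exact (pow_eq_zero_iff (by omega)).1 hy
  rw [this]
  simp; omega
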